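/- Let G be a cubic bridgeless graph that has a 2-edge-cut. Then for every edge e of G there are at least three perfect matchings of G avoiding e. -/

import Mathlib

open scoped Classical

noncomputable section

/-- A finite multigraph: finitely many vertices and edges, each edge has an
unordered pair of endpoints (parallel edges and loops are allowed). -/
structure Multigraph where
  V : Type
  E : Type
  fintypeV : Fintype V := by infer_instance
  fintypeE : Fintype E := by infer_instance
  ends : E → Sym2 V

namespace Multigraph

instance (G : Multigraph) : Fintype G.V := G.fintypeV
instance (G : Multigraph) : Fintype G.E := G.fintypeE

/-- The number of endpoints of the edge `e` that are equal to `v`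
(a loop at `v` counts twice). -/
def inc (G : Multigraph) (v : G.V) (e : G.E) : ℕ :=
  if G.ends e = Sym2.diag v then 2 else if v ∈ G.ends e then 1 else 0

/-- The degree of a vertex: the number of edge-ends at it (loops count twice). -/
def degree (G : Multigraph) (v : G.V) : ℕ := ∑ e : G.E, G.inc v e

/-- A graph is cubic if every vertex has degree three. -/
def IsCubic (G : Multigraph) : Prop := ∀ v : G.V, G.degree v = 3

/-- A perfect matching: a set of (non-loop) edges such that every vertex is
incident with exactly one edge of the set. -/
def IsPerfectMatching (G : Multigraph) (M : Finset G.E) : Prop :=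
  (∀ e ∈ M, ¬ (G.ends e).IsDiag) ∧
  ∀ v : G.V, ∃! e, e ∈ M ∧ v ∈ G.ends e

/-- The number of perfect matchings of `G`. -/
def pmCount (G : Multigraph) : ℕ :=
  Nat.card {M : Finset G.E // G.IsPerfectMatching M}

/-- Every edge lies in some perfect matching. -/
def MatchingCovered (G : Multigraph) : Prop :=
  ∀ e : G.E, ∃ M, G.IsPerfectMatching M ∧ e ∈ M

/-- Every edge lies in at least two perfect matchings. -/
def MatchingDoubleCovered (G : Multigraph) : Prop :=
  ∀ e : G.E, 2 ≤ Nat.card {M : Finset G.E // G.IsPerfectMatching M ∧ e ∈ M}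

/-- Adjacency via some edge. -/
def Adj (G : Multigraph) (u v : G.V) : Prop := ∃ e : G.E, G.ends e = s(u, v)

/-- The graph is connected. -/
def Connected (G : Multigraph) : Prop :=
  Nonempty G.V ∧ ∀ u v : G.V, Relation.ReflTransGen G.Adj u v

/-- The edge-cut `E(A, Aᶜ)`: edges with one end in `A` and the other outside. -/
def cutEdges (G : Multigraph) (A : Set G.V) : Set G.E :=
  {e | ∃ u v, G.ends e = s(u, v) ∧ u ∈ A ∧ v ∉ A}

/-- `G` is `k`-edge-connected: no edge-cut has fewer than `k` edges. -/
def EdgeConnected (G : Multigraph) (k : ℕ) : Prop :=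
  ∀ A : Set G.V, A.Nonempty → A ≠ Set.univ → k ≤ (G.cutEdges A).ncard

/-- Bridgeless = 2-edge-connected: connected with no edge-cut of size `< 2`. -/
def Bridgeless (G : Multigraph) : Prop := G.Connected ∧ G.EdgeConnected 2

/-- The subgraph induced on `A` contains a cycle (two parallel edges count as a
cycle of length two): there is a nonempty set of edges inside `A` in which every
vertex is incident with zero or at least two edge-ends. -/
def HasCycleWithin (G : Multigraph) (A : Set G.V) : Prop :=
  ∃ F : Finset G.E, F.Nonempty ∧ (∀ e ∈ F, ∀ v ∈ G.ends e, v ∈ A) ∧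
    ∀ v : G.V, (∑ e ∈ F, G.inc v e) ≠ 1

/-- The edge-cut `E(A, Aᶜ)` is cyclic: both sides contain a cycle. -/
def IsCyclicCut (G : Multigraph) (A : Set G.V) : Prop :=
  G.HasCycleWithin A ∧ G.HasCycleWithin Aᶜ

/-- `G` is cyclically `k`-edge-connected: no cyclic edge-cut has fewer than `k` edges. -/
def CyclicallyEdgeConnected (G : Multigraph) (k : ℕ) : Prop :=
  ∀ A : Set G.V, G.IsCyclicCut A → k ≤ (G.cutEdges A).ncard

/-- A cut is tight: every perfect matching contains exactly one of its edges. -/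
def IsTightCut (G : Multigraph) (A : Set G.V) : Prop :=
  ∀ M : Finset G.E, G.IsPerfectMatching M →
    (M.filter (fun e => e ∈ G.cutEdges A)).card = 1

/-- Adjacency within a set `A` of vertices. -/
def AdjOn (G : Multigraph) (A : Set G.V) (u v : G.V) : Prop :=
  u ∈ A ∧ v ∈ A ∧ G.Adj u v

/-- The subgraph induced on `A` is connected (any two of its vertices are joined
by a walk inside `A`). -/
def ConnectedOn (G : Multigraph) (A : Set G.V) : Prop :=
  ∀ u ∈ A, ∀ v ∈ A, Relation.ReflTransGen (G.AdjOn A) u v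

/-- `G` is `k`-vertex-connected: it has at least `k+1` vertices and removing any
set of at most `k-1` vertices leaves it connected. -/
def VertexConnected (G : Multigraph) (k : ℕ) : Prop :=
  k + 1 ≤ Fintype.card G.V ∧
  ∀ T : Set G.V, T.ncard ≤ k - 1 → G.ConnectedOn Tᶜ

/-- `{x, y}` is a 2-vertex-cut: removing both vertices disconnects the graph. -/
def IsVertexCutPair (G : Multigraph) (x y : G.V) : Prop :=
  x ≠ y ∧ ¬ G.ConnectedOn ({x, y}ᶜ)

/-- `G` is bipartite: the vertices split into two classes so that each edge
joins the two classes. -/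
def Bipartite (G : Multigraph) : Prop :=
  ∃ X : Set G.V, ∀ e : G.E, ∃ u v, G.ends e = s(u, v) ∧ u ∈ X ∧ v ∉ X

/-- Delete a set of edges (keeping all vertices). -/
def deleteEdges (G : Multigraph) (F : Set G.E) : Multigraph where
  V := G.V
  E := {e : G.E // e ∉ F}
  ends e := G.ends e.1

/-- Contract the vertex set `A` to a single vertex (`none`), deleting the arising
loops and keeping parallel edges. -/
def contract (G : Multigraph) (A : Set G.V) : Multigraph where
  V := Option {x : G.V // x ∉ A}
  E := {e : G.E // ¬ ∀ v ∈ G.ends e, v ∈ A}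
  ends e := (G.ends e.1).map fun x => if h : x ∈ A then none else some ⟨x, h⟩

/-- Isomorphism of multigraphs. -/
def Iso (G₁ G₂ : Multigraph) : Prop :=
  ∃ (f : G₁.V ≃ G₂.V) (g : G₁.E ≃ G₂.E), ∀ e, G₂.ends (g e) = (G₁.ends e).map f

/-- The complete graph on four vertices. -/
def K4 : Multigraph where
  V := Fin 4
  E := {p : Fin 4 × Fin 4 // p.1 < p.2}
  ends p := s(p.1.1, p.1.2)

/-- The result of simultaneously replacing every vertex of `S` by a triangle;
`σ e v` records to which of the three triangle vertices at `v` the edge `e`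
(formerly ending at `v`) is attached. -/
def expandTriangles (H : Multigraph) (S : Set H.V) (σ : H.E → H.V → Fin 3) :
    Multigraph where
  V := {x : H.V // x ∉ S} ⊕ (S × Fin 3)
  E := H.E ⊕ (S × Fin 3)
  ends e :=
    match e with
    | Sum.inl e => (H.ends e).map fun x =>
        if h : x ∈ S then Sum.inr (⟨x, h⟩, σ e x) else Sum.inl ⟨x, h⟩
    | Sum.inr (w, i) => s(Sum.inr (w, i + 1), Sum.inr (w, i + 2))

/-- `G` is obtained from `H` by replacing each vertex of `S` with a triangle:
the three edges formerly incident with a vertex of `S` get attached to the three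
distinct new triangle vertices. -/
def IsTriangleExpansion (H : Multigraph) (S : Set H.V) (G : Multigraph) : Prop :=
  ∃ σ : H.E → H.V → Fin 3,
    (∀ v ∈ S, ∀ e : H.E, H.ends e ≠ Sym2.diag v) ∧
    (∀ v ∈ S, Set.InjOn (fun e => σ e v) {e : H.E | v ∈ H.ends e}) ∧
    Iso (expandTriangles H S σ) G

/-- Klee-graphs: `K₄` together with everything obtainable by repeatedly replacing
a vertex with a triangle. -/
inductive IsKlee : Multigraph → Prop
  | k4 (G : Multigraph) : Iso K4 G → IsKlee G
  | expand (G : Multigraph) (v : G.V) (H : Multigraph) :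
      IsKlee G → IsTriangleExpansion G {v} H → IsKlee H

/-- A nice 3-edge-cut (of a cubic graph). -/
def IsNiceCut (G : Multigraph) (A : Set G.V) : Prop :=
  A.Nonempty ∧ A ≠ Set.univ ∧ (G.cutEdges A).ncard = 3 ∧
  ¬ IsKlee (G.contract A) ∧
  (¬ IsKlee (G.contract Aᶜ) ∨
   9 ≤ A.ncard ∨
   (5 ≤ A.ncard ∧ ¬ G.IsTightCut A) ∨
   (A.ncard = 3 ∧
     2 ≤ Nat.card {M : Finset G.E // G.IsPerfectMatching M ∧
       ∀ e ∈ G.cutEdges A, e ∈ M}))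

/-- A brace: a bipartite matching covered graph without nontrivial tight edge-cuts. -/
def IsBrace (H : Multigraph) : Prop :=
  H.Bipartite ∧ H.MatchingCovered ∧
  ∀ A : Set H.V, 2 ≤ A.ncard → 2 ≤ Aᶜ.ncard → ¬ H.IsTightCut A

/-- Data describing a simultaneous gluing of graphs `K w` (through their vertices
`z w`) onto the vertices `w ∈ W` of `H`: the edge `e` of `H` incident with `w`
is identified with the edge `ε w e` of `K w` incident with `z w`, whose other
end is `y w e`. -/
structure GlueData (H : Multigraph) (W : Set H.V) where
  K : W → Multigraph
  z : (w : W) → (K w).V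
  d : (w : W) → {x : (K w).V // x ≠ z w}
  ε : (w : W) → H.E → (K w).E
  y : (w : W) → H.E → {x : (K w).V // x ≠ z w}
  noloop : ∀ (w : W) (e : H.E), H.ends e ≠ Sym2.diag (w : H.V)
  noloopK : ∀ (w : W) (k : (K w).E), (K w).ends k ≠ Sym2.diag (z w)
  ends_eq : ∀ (w : W) (e : H.E), (w : H.V) ∈ H.ends e →
      (K w).ends (ε w e) = s(z w, (y w e : (K w).V))
  inj : ∀ w : W, Set.InjOn (ε w) {e : H.E | (w : H.V) ∈ H.ends e}
  surj : ∀ (w : W) (k : (K w).E), z w ∈ (K w).ends k →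
      ∃ e : H.E, (w : H.V) ∈ H.ends e ∧ ε w e = k

/-- The graph obtained by gluing each `D.K w` through `D.z w` onto the vertex
`w ∈ W` of `H`. -/
def glue (H : Multigraph) (W : Set H.V) (D : GlueData H W) : Multigraph where
  V := {x : H.V // x ∉ W} ⊕ (Σ w : W, {x : (D.K w).V // x ≠ D.z w})
  E := H.E ⊕ (Σ w : W, {k : (D.K w).E // D.z w ∉ (D.K w).ends k})
  ends e :=
    match e with
    | Sum.inl e => (H.ends e).map fun x =>
        if h : x ∈ W then Sum.inr ⟨⟨x, h⟩, D.y ⟨x, h⟩ e⟩ else Sum.inl ⟨x, h⟩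
    | Sum.inr ⟨w, k⟩ => ((D.K w).ends k.1).map fun x =>
        if h : x = D.z w then Sum.inr ⟨w, D.d w⟩ else Sum.inr ⟨w, ⟨x, h⟩⟩

/-- The multiset of vertex degrees different from three. -/
def nonCubicDegrees (G : Multigraph) : Multiset ℕ :=
  ((Finset.univ : Finset G.V).val.map G.degree).filter (· ≠ 3)

/-- `H` is an odd minor of `G`: it is obtained by contracting pairwise disjoint
connected subgraphs, each with an odd number of vertices (deleting arising loops
and keeping parallel edges). -/
def IsOddMinor (G H : Multigraph) : Prop :=
  ∃ π : G.V → H.V, Function.Surjective π ∧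
    (∀ w : H.V, G.ConnectedOn (π ⁻¹' {w}) ∧ Odd (π ⁻¹' {w}).ncard) ∧
    ∃ g : {e : G.E // ∃ u v, G.ends e = s(u, v) ∧ π u ≠ π v} ≃ H.E,
      ∀ e, H.ends (g e) = (G.ends e.1).map π

/-- The 6-vertex graph consisting of two nonadjacent vertices `x = 0`, `y = 1`
and four vertices `a = 2`, `b = 3`, `c = 4`, `d = 5`, with edges `ab`, `cd` and
an edge from each of `a`, `b`, `c`, `d` to each of `x` and `y`. -/
def specialGraph : Multigraph where
  V := Fin 6
  E := Fin 10
  ends := ![s(2, 3), s(4, 5), s(2, 0), s(2, 1), s(3, 0), s(3, 1),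
            s(4, 0), s(4, 1), s(5, 0), s(5, 1)]

/-- The perfect matching polytope: the convex hull of the characteristic vectors
of the perfect matchings. -/
def pmPolytope (G : Multigraph) : Set (G.E → ℝ) :=
  convexHull ℝ {w | ∃ M : Finset G.E, G.IsPerfectMatching M ∧
    w = fun e => if e ∈ M then (1 : ℝ) else 0}

end Multigraph

open Multigraph

/-- If a finite simple graph on an even number of vertices has no perfect matching, then some
vertex set `S` leaves at least `|S| + 2` pairwise disjoint odd sets closed under adjacency
outside `S`. -/
lemma SimpleGraph.exists_odd_family_of_no_perfectMatching {V : Type*} [Fintype V]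
    (H : SimpleGraph V) (heven : Even (Nat.card V))
    (h : ∀ M : H.Subgraph, ¬ M.IsPerfectMatching) :
    ∃ (S : Finset V) (𝒞 : Finset (Finset V)), S.card + 2 ≤ 𝒞.card ∧
      (∀ C ∈ 𝒞, Odd C.card ∧ Disjoint C S ∧ ∀ u ∈ C, ∀ v, H.Adj u v → v ∈ C ∨ v ∈ S) ∧
      (𝒞 : Set (Finset V)).PairwiseDisjoint id := by
  have htutte : ¬ ∀ u, ¬ H.IsTutteViolator u := by
    rw [← SimpleGraph.tutte]
    push Not
    exact h
  push Not at htutte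
  obtain ⟨S, hS⟩ := htutte
  unfold SimpleGraph.IsTutteViolator at hS
  set K := ((⊤ : H.Subgraph).deleteVerts S).coe with hK
  have hcard : S.ncard + Nat.card ((⊤ : H.Subgraph).deleteVerts S).verts = Nat.card V := by
    have : ((⊤ : H.Subgraph).deleteVerts S).verts = Sᶜ := by
      ext; simp
    rw [this, Nat.card_coe_set_eq, Set.ncard_add_ncard_compl]
  have hodd := K.odd_ncard_oddComponents
  have hlarge : S.ncard + 2 ≤ K.oddComponents.ncard := by
    by_contra hlt
    have heq : K.oddComponents.ncard = S.ncard + 1 := by lia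
    rw [heq] at hodd
    rw [← hcard] at heven
    grind
  let f : K.ConnectedComponent → Finset V := fun c => (Subtype.val '' c.supp).toFinset
  have hmem : ∀ c (v : V), v ∈ f c ↔ ∃ hv, K.connectedComponentMk ⟨v, hv⟩ = c := by
    intro c v
    simp [f, SimpleGraph.ConnectedComponent.mem_supp_iff]
  have hinj : Function.Injective f := by
    intro c d hcd
    obtain ⟨x, hx⟩ := c.nonempty_supp
    have hxc : (x : V) ∈ f c := (hmem c x).2 ⟨x.2, hx⟩
    rw [hcd] at hxc
    obtain ⟨_, hd⟩ := (hmem d x).1 hxc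
    exact hx.symm.trans hd
  refine ⟨S.toFinset, K.oddComponents.toFinset.image f, ?_, ?_, ?_⟩
  · rw [Finset.card_image_of_injective _ hinj, ← Set.ncard_eq_toFinset_card',
      ← Set.ncard_eq_toFinset_card']
    exact hlarge
  · intro C hC
    obtain ⟨c, hc, rfl⟩ := Finset.mem_image.1 hC
    refine ⟨?_, ?_, ?_⟩
    · have : (f c).card = c.supp.ncard := by
        rw [← Set.ncard_eq_toFinset_card', Set.ncard_image_of_injective _ Subtype.val_injective]
      rw [this]
      simpa using hc
    · rw [Finset.disjoint_left]
      intro v hv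
      obtain ⟨hv, -⟩ := (hmem c v).1 hv
      simpa using hv
    · intro u hu v huv
      obtain ⟨hu', hc⟩ := (hmem c u).1 hu
      by_cases hvS : v ∈ S
      · simp [hvS]
      · left
        have hv' : v ∈ ((⊤ : H.Subgraph).deleteVerts S).verts := by simp [hvS]
        refine (hmem c v).2 ⟨hv', ?_⟩
        rw [← hc]
        refine (SimpleGraph.ConnectedComponent.connectedComponentMk_eq_of_adj ?_).symm
        have huS : u ∉ S := by simpa using hu'
        simp [hK, huS, hvS, huv]
  · rintro C hC D hD hCD
    simp only [Finset.coe_image, Set.mem_image] at hC hD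
    obtain ⟨c, -, rfl⟩ := hC
    obtain ⟨d, -, rfl⟩ := hD
    refine Finset.disjoint_left.2 fun v hv hv' => hCD ?_
    obtain ⟨_, h1⟩ := (hmem c v).1 hv
    obtain ⟨_, h2⟩ := (hmem d v).1 hv'
    rw [← h1, ← h2]

namespace Multigraph

variable {G : Multigraph}

lemma inc_eq {u v : G.V} {k : G.E} (hk : G.ends k = s(u, v)) (w : G.V) :
    G.inc w k = (if w = u then 1 else 0) + (if w = v then 1 else 0) := by
  unfold inc
  rw [hk]
  by_cases h1 : w = u <;> by_cases h2 : w = v <;> simp_all [Sym2.diag] <;> grind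

lemma sum_inc_eq {u v : G.V} {k : G.E} (hk : G.ends k = s(u, v)) (C : Finset G.V) :
    ∑ w ∈ C, G.inc w k = (if u ∈ C then 1 else 0) + (if v ∈ C then 1 else 0) := by
  simp only [inc_eq hk, Finset.sum_add_distrib, Finset.sum_ite_eq']

lemma mem_cutEdges_iff {u v : G.V} {k : G.E} (hk : G.ends k = s(u, v)) (A : Set G.V) :
    k ∈ G.cutEdges A ↔ (u ∈ A ∧ v ∉ A) ∨ (v ∈ A ∧ u ∉ A) := by
  simp only [cutEdges, Set.mem_ofPred_eq, hk, Sym2.eq_iff]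
  grind

lemma card_filter_cutEdges_mod_two (F : Finset G.E) (C : Finset G.V) :
    (F.filter (· ∈ G.cutEdges C)).card % 2 = (∑ w ∈ C, ∑ k ∈ F, G.inc w k) % 2 := by
  rw [Finset.sum_comm, Finset.card_filter, Finset.sum_nat_mod,
    Finset.sum_nat_mod (f := fun k => ∑ w ∈ C, G.inc w k)]
  congr 1
  refine Finset.sum_congr rfl fun k _ => ?_
  obtain ⟨⟨u, v⟩, hk⟩ := Sym2.mk_surjective (G.ends k)
  replace hk : G.ends k = s(u, v) := hk.symm
  simp only [sum_inc_eq hk, mem_cutEdges_iff hk, Finset.mem_coe]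
  by_cases h1 : u ∈ C <;> by_cases h2 : v ∈ C <;> simp [h1, h2]

lemma ncard_cutEdges_eq_card_filter (A : Set G.V) :
    (G.cutEdges A).ncard = (Finset.univ.filter (· ∈ G.cutEdges A)).card := by
  rw [← Set.ncard_coe_finset]
  simp

lemma IsCubic.ncard_cutEdges_mod_two (hG : G.IsCubic) (C : Finset G.V) :
    (G.cutEdges C).ncard % 2 = C.card % 2 := by
  rw [ncard_cutEdges_eq_card_filter, card_filter_cutEdges_mod_two]
  have h : ∀ w, ∑ k, G.inc w k = 3 := hG
  simp only [h, Finset.sum_const, smul_eq_mul]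
  lia

lemma IsPerfectMatching.sum_inc {M : Finset G.E} (hM : G.IsPerfectMatching M) (v : G.V) :
    ∑ k ∈ M, G.inc v k = 1 := by
  obtain ⟨k, ⟨hkM, hvk⟩, huniq⟩ := hM.2 v
  rw [Finset.sum_eq_single_of_mem k hkM]
  · have hdiag : G.ends k ≠ Sym2.diag v := fun h => hM.1 k hkM (h ▸ Sym2.diag_isDiag v)
    simp [inc, hdiag, hvk]
  · intro l hl hlk
    have hvl : v ∉ G.ends l := fun h => hlk (huniq l ⟨hl, h⟩)
    have hdiag : G.ends l ≠ Sym2.diag v := fun h => hvl (by simp [h, Sym2.diag])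
    simp [inc, hdiag, hvl]

lemma IsPerfectMatching.card_filter_cutEdges_mod_two {M : Finset G.E}
    (hM : G.IsPerfectMatching M) (C : Finset G.V) :
    (M.filter (· ∈ G.cutEdges C)).card % 2 = C.card % 2 := by
  simp [Multigraph.card_filter_cutEdges_mod_two, hM.sum_inc]

/-- The number of crossed members of a disjoint family, for edges that leave a member only
towards `S`. -/
lemma card_filter_mem_cutEdges_le {k : G.E} {S : Finset G.V} {𝒞 : Finset (Finset G.V)}
    (hS : ∀ C ∈ 𝒞, Disjoint C S) (hdisj : (𝒞 : Set (Finset G.V)).PairwiseDisjoint id)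
    (hk : ∀ C ∈ 𝒞, ∀ u ∈ C, ∀ v, G.ends k = s(u, v) → v ∈ C ∨ v ∈ S) :
    (𝒞.filter fun C : Finset G.V => k ∈ G.cutEdges (C : Set G.V)).card ≤ ∑ v ∈ S, G.inc v k := by
  obtain ⟨⟨u, v⟩, huv⟩ := Sym2.mk_surjective (G.ends k)
  replace huv : G.ends k = s(u, v) := huv.symm
  have hvu : G.ends k = s(v, u) := huv.trans Sym2.eq_swap
  have heq : ∀ C ∈ 𝒞, ∀ D ∈ 𝒞, ∀ x, x ∈ C → x ∈ D → C = D := fun C hC D hD x hx hx' => by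
    by_contra hne
    exact Finset.disjoint_left.1 (hdisj hC hD hne) hx hx'
  have hnot : ∀ C ∈ 𝒞, ∀ x ∈ C, x ∉ S := fun C hC x hx => Finset.disjoint_left.1 (hS C hC) hx
  rw [sum_inc_eq huv]
  rcases (𝒞.filter fun C : Finset G.V => k ∈ G.cutEdges (C : Set G.V)).eq_empty_or_nonempty with h | ⟨C, hC⟩
  · simp [h]
  · have hone : (𝒞.filter fun C : Finset G.V => k ∈ G.cutEdges (C : Set G.V)).card ≤ 1 := by
      refine Finset.card_le_one.2 fun C hC D hD => ?_
      simp only [Finset.mem_filter, mem_cutEdges_iff huv, Finset.mem_coe] at hC hD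
      grind
    simp only [Finset.mem_filter, mem_cutEdges_iff huv, Finset.mem_coe] at hC
    have : u ∈ S ∨ v ∈ S := by grind
    grind

lemma card_filter_mem_cutEdges_le_two (k : G.E) {𝒞 : Finset (Finset G.V)}
    (hdisj : (𝒞 : Set (Finset G.V)).PairwiseDisjoint id) :
    (𝒞.filter fun C : Finset G.V => k ∈ G.cutEdges (C : Set G.V)).card ≤ 2 := by
  obtain ⟨⟨u, v⟩, huv⟩ := Sym2.mk_surjective (G.ends k)
  replace huv : G.ends k = s(u, v) := huv.symm
  have hone : ∀ x, (𝒞.filter fun C => x ∈ C).card ≤ 1 := by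
    intro x
    refine Finset.card_le_one.2 fun C hC D hD => ?_
    simp only [Finset.mem_filter] at hC hD
    by_contra hne
    exact Finset.disjoint_left.1 (hdisj hC.1 hD.1 hne) hC.2 hD.2
  calc (𝒞.filter fun C : Finset G.V => k ∈ G.cutEdges (C : Set G.V)).card
      ≤ (𝒞.filter (fun C => u ∈ C) ∪ 𝒞.filter (fun C => v ∈ C)).card := by
        refine Finset.card_le_card fun C => ?_
        simp only [Finset.mem_filter, Finset.mem_union, mem_cutEdges_iff huv, Finset.mem_coe]
        grind
    _ ≤ 2 := (Finset.card_union_le _ _).trans (add_le_add (hone u) (hone v))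

/-- The simple graph joining the distinct vertices adjacent through an edge outside `F`. -/
def simpleAvoiding (G : Multigraph) (F : Finset G.E) : SimpleGraph G.V where
  Adj u v := u ≠ v ∧ ∃ k ∉ F, G.ends k = s(u, v)
  symm := ⟨fun _ _ ⟨hne, k, hk, h⟩ => ⟨hne.symm, k, hk, h.trans Sym2.eq_swap⟩⟩
  loopless := ⟨fun _ h => h.1 rfl⟩

lemma exists_isPerfectMatching_of_simpleAvoiding {F : Finset G.E}
    {M : (G.simpleAvoiding F).Subgraph} (hM : M.IsPerfectMatching) :
    ∃ N, G.IsPerfectMatching N ∧ Disjoint N F := by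
  have hedge : ∀ z ∈ M.edgeSet, ∃ k ∉ F, G.ends k = z := by
    intro z
    induction z using Sym2.ind with
    | _ u v => exact fun h => (M.adj_sub h).2
  choose φ hφF hφ using hedge
  refine ⟨Finset.univ.filter fun k => ∃ z hz, φ z hz = k, ⟨?_, fun v => ?_⟩, ?_⟩
  · simp only [Finset.mem_filter, Finset.mem_univ, true_and]
    rintro _ ⟨z, hz, rfl⟩
    rw [hφ z hz]
    exact (G.simpleAvoiding F).not_isDiag_of_mem_edgeSet (M.edgeSet_subset hz)
  · obtain ⟨w, hw, huniq⟩ := SimpleGraph.Subgraph.isPerfectMatching_iff.1 hM v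
    refine ⟨φ s(v, w) hw, ⟨?_, ?_⟩, ?_⟩
    · simp only [Finset.mem_filter, Finset.mem_univ, true_and]
      exact ⟨_, _, rfl⟩
    · rw [hφ _ hw]
      exact Sym2.mem_mk_left v w
    · simp only [Finset.mem_filter, Finset.mem_univ, true_and]
      rintro _ ⟨⟨z, hz, rfl⟩, hv⟩
      rw [hφ z hz] at hv
      obtain ⟨y, rfl⟩ := hv
      obtain rfl := huniq y hz
      rfl
  · rw [Finset.disjoint_left]
    simp only [Finset.mem_filter, Finset.mem_univ, true_and]
    rintro _ ⟨z, hz, rfl⟩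
    exact hφF z hz

/-- **Plesník's theorem** for cubic graphs: deleting at most two edges of a bridgeless cubic
graph leaves a graph with a perfect matching. -/
theorem exists_isPerfectMatching_avoiding (hG : G.IsCubic) (hb : G.EdgeConnected 2)
    (F : Finset G.E) (hF : F.card ≤ 2) :
    ∃ M, G.IsPerfectMatching M ∧ Disjoint M F := by
  have hcardV : Fintype.card G.V % 2 = 0 := by
    have h := hG.ncard_cutEdges_mod_two Finset.univ
    have hempty : G.cutEdges Set.univ = ∅ := by
      ext; simp [cutEdges]
    rw [Finset.coe_univ, hempty, Set.ncard_empty, Finset.card_univ] at h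
    lia
  by_contra hno
  have hfree : ∀ M : (G.simpleAvoiding F).Subgraph, ¬ M.IsPerfectMatching :=
    fun M hM => hno (exists_isPerfectMatching_of_simpleAvoiding hM)
  obtain ⟨S, 𝒞, hcard, h𝒞, hdisj⟩ :=
    (G.simpleAvoiding F).exists_odd_family_of_no_perfectMatching
      (by rw [Nat.card_eq_fintype_card, Nat.even_iff]; exact hcardV) hfree
  have hlower : ∀ C ∈ 𝒞, 3 ≤ (G.cutEdges (C : Set G.V)).ncard := by
    intro C hC
    have hodd := Nat.odd_iff.1 (h𝒞 C hC).1
    have hpar := hG.ncard_cutEdges_mod_two C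
    have htwo := hb C (Finset.coe_nonempty.2 (Finset.card_pos.1 (by lia))) fun h => by
      rw [Finset.coe_eq_univ] at h
      rw [h, Finset.card_univ] at hodd
      lia
    lia
  have hupper : ∀ k, (𝒞.filter fun C : Finset G.V => k ∈ G.cutEdges (C : Set G.V)).card ≤
      ∑ v ∈ S, G.inc v k + if k ∈ F then 2 else 0 := by
    intro k
    by_cases hk : k ∈ F
    · simpa [hk] using (card_filter_mem_cutEdges_le_two k hdisj).trans (Nat.le_add_left _ _)
    · simp only [hk, if_false, add_zero]
      refine card_filter_mem_cutEdges_le (fun C hC => (h𝒞 C hC).2.1) hdisj ?_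
      intro C hC u hu v huv
      by_cases hne : u = v
      · exact Or.inl (hne ▸ hu)
      · exact (h𝒞 C hC).2.2 u hu v ⟨hne, k, hk, huv⟩
  have hdeg : ∀ v, ∑ k, G.inc v k = 3 := hG
  have hcount : 𝒞.card * 3 ≤ S.card * 3 + F.card * 2 :=
    calc 𝒞.card * 3 ≤ ∑ C ∈ 𝒞, (G.cutEdges (C : Set G.V)).ncard := by
          simpa using Finset.card_nsmul_le_sum 𝒞 _ 3 hlower
      _ = ∑ k, (𝒞.filter fun C : Finset G.V => k ∈ G.cutEdges (C : Set G.V)).card := by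
          simp only [ncard_cutEdges_eq_card_filter, Finset.card_filter]
          exact Finset.sum_comm
      _ ≤ ∑ k, (∑ v ∈ S, G.inc v k + if k ∈ F then 2 else 0) :=
          Finset.sum_le_sum fun k _ => hupper k
      _ = S.card * 3 + F.card * 2 := by
          rw [Finset.sum_add_distrib, Finset.sum_comm]
          simp [hdeg]
  lia

/-- The edge set agreeing with `M` on edges touching `A` and with `N` on the others. -/
def splice (G : Multigraph) (A : Set G.V) (M N : Finset G.E) : Finset G.E :=
  Finset.univ.filter fun k => if ∃ v ∈ G.ends k, v ∈ A then k ∈ M else k ∈ N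

lemma mem_cutEdges_of_mem_ends {A : Set G.V} {k : G.E} {u v : G.V} (hu : u ∈ G.ends k)
    (hv : v ∈ G.ends k) (huA : u ∈ A) (hvA : v ∉ A) : k ∈ G.cutEdges A :=
  ⟨u, v, (Sym2.mem_and_mem_iff (by rintro rfl; exact hvA huA)).1 ⟨hu, hv⟩, huA, hvA⟩

lemma mem_splice_of_mem {A : Set G.V} {M N : Finset G.E} {k : G.E} {v : G.V}
    (hv : v ∈ G.ends k) (hvA : v ∈ A) : k ∈ G.splice A M N ↔ k ∈ M := by
  have h : ∃ v ∈ G.ends k, v ∈ A := ⟨v, hv, hvA⟩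
  simp [splice, h]

lemma mem_splice_of_notMem {A : Set G.V} {M N : Finset G.E} {k : G.E} {v : G.V}
    (hM : ∀ k ∈ M, k ∉ G.cutEdges A) (hN : ∀ k ∈ N, k ∉ G.cutEdges A)
    (hv : v ∈ G.ends k) (hvA : v ∉ A) : k ∈ G.splice A M N ↔ k ∈ N := by
  by_cases h : ∃ u ∈ G.ends k, u ∈ A
  · obtain ⟨u, hu, huA⟩ := h
    have hcut := mem_cutEdges_of_mem_ends hu hv huA hvA
    rw [mem_splice_of_mem hu huA]
    exact iff_of_false (fun h => hM k h hcut) (fun h => hN k h hcut)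
  · simp [splice, h]

lemma IsPerfectMatching.splice {A : Set G.V} {M N : Finset G.E} (hM : G.IsPerfectMatching M)
    (hN : G.IsPerfectMatching N) (hMA : ∀ k ∈ M, k ∉ G.cutEdges A)
    (hNA : ∀ k ∈ N, k ∉ G.cutEdges A) : G.IsPerfectMatching (G.splice A M N) := by
  refine ⟨fun k hk => ?_, fun v => ?_⟩
  · simp only [Multigraph.splice, Finset.mem_filter, Finset.mem_univ, true_and] at hk
    split_ifs at hk
    · exact hM.1 k hk
    · exact hN.1 k hk
  · by_cases hv : v ∈ A
    · refine (existsUnique_congr fun k => ?_).2 (hM.2 v)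
      exact and_congr_left fun h => mem_splice_of_mem h hv
    · refine (existsUnique_congr fun k => ?_).2 (hN.2 v)
      exact and_congr_left fun h => mem_splice_of_notMem hMA hNA h hv

lemma cutEdges_compl (A : Set G.V) : G.cutEdges Aᶜ = G.cutEdges A := by
  ext k
  obtain ⟨⟨u, v⟩, hk⟩ := Sym2.mk_surjective (G.ends k)
  replace hk : G.ends k = s(u, v) := hk.symm
  simp only [mem_cutEdges_iff hk, Set.mem_compl_iff]
  tauto

/-- A perfect matching avoiding one edge of a 2-edge-cut of a cubic graph avoids both. -/
lemma IsPerfectMatching.notMem_cutEdges {M : Finset G.E} {A : Set G.V} {f : G.E}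
    (hM : G.IsPerfectMatching M) (hG : G.IsCubic) (hcut : (G.cutEdges A).ncard = 2)
    (hf : f ∈ G.cutEdges A) (hfM : f ∉ M) : ∀ k ∈ M, k ∉ G.cutEdges A := by
  have h1 := hG.ncard_cutEdges_mod_two A.toFinset
  have h2 := hM.card_filter_cutEdges_mod_two A.toFinset
  rw [Set.coe_toFinset] at h1 h2
  have hlt : (M.filter (· ∈ G.cutEdges A)).card < 2 := by
    rw [← hcut, ncard_cutEdges_eq_card_filter]
    refine Finset.card_lt_card (Finset.ssubset_iff_of_subset ?_ |>.2 ⟨f, by simp [hf], ?_⟩)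
    · exact Finset.filter_subset_filter _ (Finset.subset_univ _)
    · simp [hfM]
  have hzero : M.filter (· ∈ G.cutEdges A) = ∅ := Finset.card_eq_zero.1 (by lia)
  exact Finset.filter_eq_empty_iff.1 hzero

lemma three_le_card_avoiding_of_end_mem (hG : G.IsCubic) (hb : G.EdgeConnected 2)
    {A : Set G.V} (hcut : (G.cutEdges A).ncard = 2) {e : G.E} {u : G.V}
    (hue : u ∈ G.ends e) (huA : u ∈ A) :
    3 ≤ Nat.card {M : Finset G.E // G.IsPerfectMatching M ∧ e ∉ M} := by
  obtain ⟨f, hf⟩ : (G.cutEdges A).Nonempty := Set.nonempty_of_ncard_ne_zero (by lia)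
  have avoid : ∀ k l, ∃ M, G.IsPerfectMatching M ∧ k ∉ M ∧ l ∉ M := by
    intro k l
    obtain ⟨M, hM, hd⟩ := exists_isPerfectMatching_avoiding hG hb {k, l} Finset.card_le_two
    exact ⟨M, hM, by simpa using hd⟩
  obtain ⟨a, b, hfab, haA, hbA⟩ := id hf
  obtain ⟨M, hM, heM, hfM⟩ := avoid e f
  have hMA := hM.notMem_cutEdges hG hcut hf hfM
  obtain ⟨x, ⟨hxM, hux⟩, -⟩ := hM.2 u
  obtain ⟨z, ⟨hzM, hbz⟩, -⟩ := hM.2 b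
  obtain ⟨N, hN, hzN, hfN⟩ := avoid z f
  have hNA := hN.notMem_cutEdges hG hcut hf hfN
  obtain ⟨K, hK, heK, hxK⟩ := avoid e x
  have heP : e ∉ G.splice A M N := by rwa [mem_splice_of_mem hue huA]
  have hxP : x ∈ G.splice A M N := by rwa [mem_splice_of_mem hux huA]
  have hzP : z ∉ G.splice A M N := by rwa [mem_splice_of_notMem hMA hNA hbz hbA]
  have hsub : ({M, G.splice A M N, K} : Finset (Finset G.E)) ⊆
      Finset.univ.filter fun M => G.IsPerfectMatching M ∧ e ∉ M := by
    simp [Finset.insert_subset_iff, hM, heM, hM.splice hN hMA hNA, heP, hK, heK]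
  rw [Nat.card_eq_fintype_card, Fintype.card_subtype]
  refine le_of_eq_of_le (Finset.card_eq_three.2 ⟨_, _, _, ?_, ?_, ?_, rfl⟩).symm
    (Finset.card_le_card hsub)
  · rintro h
    exact hzP (h ▸ hzM)
  · rintro rfl
    exact hxK hxM
  · intro h
    exact hxK (h ▸ hxP)

end Multigraph

/-- Let `G` be a cubic bridgeless graph that has a 2-edge-cut.
Then for every edge `e` of `G` there are at least three perfect matchings of `G`
avoiding `e`. -/
theorem cubic_bridgeless_twoCut_three_matchings_avoiding (G : Multigraph)
    (hcubic : G.IsCubic) (hbridgeless : G.Bridgeless)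
    (A : Set G.V) (hA : A.Nonempty) (hA' : A ≠ Set.univ)
    (hcut : (G.cutEdges A).ncard = 2) (e : G.E) :
    3 ≤ Nat.card {M : Finset G.E // G.IsPerfectMatching M ∧ e ∉ M} := by
  obtain ⟨u, hu⟩ : ∃ u, u ∈ G.ends e := ⟨_, Sym2.out_fst_mem (G.ends e)⟩
  by_cases huA : u ∈ A
  · exact three_le_card_avoiding_of_end_mem hcubic hbridgeless.2 hcut hu huA
  · exact three_le_card_avoiding_of_end_mem hcubic hbridgeless.2
      (A := Aᶜ) (by rwa [cutEdges_compl]) hu huA
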